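/- There exist constants c₁, c₂ > 0 and a threshold W such that for every integer w ≥ W, the number κ(2,w) of equivalence classes of 2-dimensional convex lattice polytopes P with |P ∩ ℤ²| = w is finite and satisfies exp(c₁·w^{1/3}) ≤ κ(2,w) ≤ exp(c₂·w^{1/3}). -/

import Mathlib

open MeasureTheory

noncomputable section

/-- The canonical embedding of integer vectors into real vectors. -/
def intVec {d : ℕ} (x : Fin d → ℤ) : Fin d → ℝ := fun i => (x i : ℝ)

/-- `P` is a convex lattice polytope: the convex hull of a finite set of lattice points. -/
def IsConvexLatticePolytope (d : ℕ) (P : Set (Fin d → ℝ)) : Prop :=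
  ∃ V : Finset (Fin d → ℤ), P = convexHull ℝ (intVec '' (V : Set (Fin d → ℤ)))

/-- `P` is `d`-dimensional: its affine span is all of `ℝ^d`. -/
def IsFullDim (d : ℕ) (P : Set (Fin d → ℝ)) : Prop :=
  affineSpan ℝ P = ⊤

/-- The set of lattice points of `P`. -/
def latticePts (d : ℕ) (P : Set (Fin d → ℝ)) : Set (Fin d → ℤ) :=
  {x | intVec x ∈ P}

/-- The lattice `ℤ^d` viewed inside `ℝ^d`. -/
def latticeSet (d : ℕ) : Set (Fin d → ℝ) := Set.range (intVec (d := d))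

/-- Two subsets of `ℝ^d` are lattice-equivalent if some affine bijection of `ℝ^d`
preserving `ℤ^d` maps one onto the other. -/
def LatticeEquiv (d : ℕ) (P₁ P₂ : Set (Fin d → ℝ)) : Prop :=
  ∃ σ : (Fin d → ℝ) ≃ᵃ[ℝ] (Fin d → ℝ), σ '' latticeSet d = latticeSet d ∧ P₂ = σ '' P₁

/-- The type of equivalence classes of `d`-dimensional convex lattice polytopes
satisfying the predicate `Q`, modulo lattice equivalence. -/
def ClassesType (d : ℕ) (Q : Set (Fin d → ℝ) → Prop) : Type :=
  Quot (fun P₁ P₂ : {P : Set (Fin d → ℝ) // IsConvexLatticePolytope d P ∧ IsFullDim d P ∧ Q P} =>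
    LatticeEquiv d P₁.1 P₂.1)

/-- `P` is centrally symmetric (with some center `c`, i.e. `P = 2c - P`). -/
def IsCentrallySymmetric (d : ℕ) (P : Set (Fin d → ℝ)) : Prop :=
  ∃ c : Fin d → ℝ, ∀ x, x ∈ P ↔ (2 : ℝ) • c - x ∈ P

/-- Finsets of positive grid vectors with bounded total. -/
def stepSets (A B : ℕ) : Finset (Finset (ℕ × ℕ)) :=
  ((Finset.Icc 1 A ×ˢ Finset.Icc 1 B).powerset).filter
    (fun D => ∑ d ∈ D, d.1 ≤ A ∧ ∑ d ∈ D, d.2 ≤ B)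

lemma sum_exp_le (s : ℝ) (hs : 0 < s) (A : ℕ) :
    ∑ i ∈ Finset.Icc 1 A, Real.exp (-(s * i)) ≤ 1 / s := by
  have key : ∀ A : ℕ, ∑ i ∈ Finset.Icc 1 A, Real.exp (-(s * i)) ≤ (1 / s) * (1 - Real.exp (-(s * A))) := by
    intro A
    induction A with
    | zero => simp
    | succ k ih =>
      rw [Finset.sum_Icc_succ_top (by omega)]
      have e : Real.exp (-(s * k)) = Real.exp (-(s * ((k+1 : ℕ) : ℝ))) * Real.exp s := by
        rw [← Real.exp_add]; congr 1; push_cast; ring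
      have h1 := Real.add_one_le_exp s
      have h2 := Real.exp_pos (-(s * ((k+1 : ℕ) : ℝ)))
      set E := Real.exp (-(s * ((k+1 : ℕ) : ℝ)))
      rw [e] at ih
      have : (1 / s) * (1 - E * Real.exp s) + E ≤ (1 / s) * (1 - E) := by
        rw [← sub_nonneg]
        have : (1 / s) * (1 - E) - ((1 / s) * (1 - E * Real.exp s) + E) =
          (1 / s) * E * (Real.exp s - (s + 1)) := by
          field_simp; ring
        rw [this]
        have := sub_nonneg.2 h1
        positivity
      linarith
  refine (key A).trans ?_
  have := Real.exp_pos (-(s * A))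
  have h3 : 0 < 1 / s := by positivity
  nlinarith

lemma card_stepSets_le (A B : ℕ) (hA : 1 ≤ A) (hB : 1 ≤ B) :
    ((stepSets A B).card : ℝ) ≤ Real.exp (3 * ((A : ℝ) * B) ^ ((1 : ℝ) / 3)) := by
  have hA' : (0 : ℝ) < A := by exact_mod_cast hA
  have hB' : (0 : ℝ) < B := by exact_mod_cast hB
  set m := ((A : ℝ) * B) ^ ((1 : ℝ) / 3) with hm
  have hmpos : 0 < m := by positivity
  have hm3 : m ^ 3 = A * B := by
    rw [hm, ← Real.rpow_natCast, ← Real.rpow_mul (by positivity)]; norm_num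
  set s := m / A
  set t := m / B
  have hs : 0 < s := by positivity
  have ht : 0 < t := by positivity
  set G := Finset.Icc 1 A ×ˢ Finset.Icc 1 B
  set F : ℕ × ℕ → ℝ := fun d => Real.exp (-(s * d.1)) * Real.exp (-(t * d.2)) with hF
  have hprodF : ∀ D : Finset (ℕ × ℕ), ∏ d ∈ D, F d =
      Real.exp (-(s * (∑ d ∈ D, d.1 : ℕ)) - t * (∑ d ∈ D, d.2 : ℕ)) := by
    intro D
    simp only [hF, Finset.prod_mul_distrib, ← Real.exp_sum]
    rw [← Real.exp_add]
    congr 1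
    push_cast
    rw [Finset.mul_sum, Finset.mul_sum, Finset.sum_neg_distrib, Finset.sum_neg_distrib]; ring
  have h1 : ((stepSets A B).card : ℝ) * Real.exp (-(s * A) - t * B) ≤ ∏ d ∈ G, (1 + F d) := by
    rw [Finset.prod_one_add, ← nsmul_eq_mul]
    refine le_trans ?_ (Finset.sum_le_sum_of_subset_of_nonneg (s := stepSets A B)
      (Finset.filter_subset _ _) ?_)
    · apply Finset.card_nsmul_le_sum
      intro D hD
      rw [stepSets, Finset.mem_filter] at hD
      rw [hprodF]
      apply Real.exp_le_exp.2
      have a1 : ((∑ d ∈ D, d.1 : ℕ) : ℝ) ≤ A := by exact_mod_cast hD.2.1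
      have a2 : ((∑ d ∈ D, d.2 : ℕ) : ℝ) ≤ B := by exact_mod_cast hD.2.2
      have := mul_le_mul_of_nonneg_left a1 hs.le
      have := mul_le_mul_of_nonneg_left a2 ht.le
      linarith
    · intro D _ _
      rw [hprodF]; positivity
  have h2 : ∏ d ∈ G, (1 + F d) ≤ Real.exp m := by
    calc ∏ d ∈ G, (1 + F d) ≤ ∏ d ∈ G, Real.exp (F d) := by
          apply Finset.prod_le_prod
          · intro d _; have : 0 < F d := by simp only [hF]; positivity
            linarith
          · intro d _; have := Real.add_one_le_exp (F d); linarith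
      _ = Real.exp (∑ d ∈ G, F d) := by rw [Real.exp_sum]
      _ ≤ Real.exp m := by
          apply Real.exp_le_exp.2
          have : ∑ d ∈ G, F d = (∑ i ∈ Finset.Icc 1 A, Real.exp (-(s * i))) *
              ∑ j ∈ Finset.Icc 1 B, Real.exp (-(t * j)) := by
            rw [Finset.sum_mul_sum, Finset.sum_product]
          rw [this]
          have e : (1 / s) * (1 / t) = m := by
            simp only [s, t]
            field_simp
            rw [← hm3]
          rw [← e]
          apply mul_le_mul (sum_exp_le s hs A) (sum_exp_le t ht B)
          · positivity
          · positivity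
  have h3 : s * A = m := by simp only [s]; field_simp
  have h4 : t * B = m := by simp only [t]; field_simp
  rw [h3, h4] at h1
  have h5 : Real.exp (3 * m) = Real.exp m * (Real.exp (-m - m))⁻¹ := by
    rw [← Real.exp_neg, ← Real.exp_add]; congr 1; ring
  rw [h5, ← div_eq_mul_inv, le_div_iff₀ (Real.exp_pos _)]
  exact h1.trans h2

/-- Strictly decreasing, strictly concave finite lattice chains. -/
def NEChain (U : Finset (Fin 2 → ℤ)) : Prop :=
  (∀ p ∈ U, ∀ q ∈ U, p ≠ q → (p 0 < q 0 ∧ q 1 < p 1) ∨ (q 0 < p 0 ∧ p 1 < q 1)) ∧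
  (∀ p ∈ U, ∀ q ∈ U, ∀ r ∈ U, p 0 < q 0 → q 0 < r 0 →
    (p 1 - q 1) * (r 0 - q 0) < (q 1 - r 1) * (q 0 - p 0))

/-- Difference between two consecutive chain points. -/
def stepOf (p q : Fin 2 → ℤ) : ℕ × ℕ := ((q 0 - p 0).toNat, (p 1 - q 1).toNat)

/-- Consecutive differences of a list of points. -/
def stepsOf : List (Fin 2 → ℤ) → List (ℕ × ℕ)
  | [] => []
  | [_] => []
  | p :: q :: l => stepOf p q :: stepsOf (q :: l)

/-- Consecutive points of a chain. -/
def chainLt (p q : Fin 2 → ℤ) : Prop := p 0 < q 0 ∧ q 1 < p 1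

/-- Strict comparison of slopes of positive vectors. -/
def slopeLt (d e : ℕ × ℕ) : Prop :=
  0 < d.1 ∧ 0 < d.2 ∧ 0 < e.1 ∧ 0 < e.2 ∧ d.2 * e.1 < e.2 * d.1

instance : IsTrans (ℕ × ℕ) slopeLt where
  trans := by
    rintro ⟨a, b⟩ ⟨c, d⟩ ⟨e, f⟩ ⟨h1, h2, h3, h4, h5⟩ ⟨g1, g2, g3, g4, g5⟩
    refine ⟨h1, h2, g3, g4, ?_⟩
    simp only at *
    have : (b * e) * (c * d) < (f * a) * (c * d) := by
      calc (b * e) * (c * d) = (b * c) * (d * e) := by ring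
        _ < (d * a) * (f * c) := by
          apply Nat.mul_lt_mul_of_lt_of_lt h5 g5
        _ = _ := by ring
    exact lt_of_mul_lt_mul_right this (by positivity)

lemma slopeLt_asymm (d e : ℕ × ℕ) (h : slopeLt d e) (h' : slopeLt e d) : False := by
  obtain ⟨-, -, -, -, h⟩ := h
  obtain ⟨-, -, -, -, h'⟩ := h'
  nlinarith

lemma NEChain.exists_list {U : Finset (Fin 2 → ℤ)} (h : NEChain U) :
    ∃ l : List (Fin 2 → ℤ), l.toFinset = U ∧ l.Pairwise chainLt := by
  classical
  refine ⟨U.toList.mergeSort (fun p q => decide (p 0 ≤ q 0)), ?_, ?_⟩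
  · ext x; simp
  · have h1 : (U.toList.mergeSort (fun p q => decide (p 0 ≤ q 0))).Pairwise
        (fun p q => decide (p 0 ≤ q 0) = true) := by
      apply List.pairwise_mergeSort
      · intro a b c; simp only [decide_eq_true_eq]; omega
      · intro a b; simp only [Bool.or_eq_true, decide_eq_true_eq]; omega
    have h2 : (U.toList.mergeSort (fun p q => decide (p 0 ≤ q 0))).Nodup :=
      (List.mergeSort_perm _ _).nodup_iff.2 U.nodup_toList
    refine (List.Pairwise.and_mem.1 (h1.and h2)).imp ?_
    rintro p q ⟨hp, hq, h3, h4⟩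
    simp only [List.mem_mergeSort, Finset.mem_toList] at hp hq
    simp only [decide_eq_true_eq] at h3
    rcases h.1 p hp q hq h4 with h5 | h5
    · exact h5
    · omega

lemma stepsOf_chain (l : List (Fin 2 → ℤ)) (hl : l.Pairwise chainLt)
    (hc : ∀ p ∈ l, ∀ q ∈ l, ∀ r ∈ l, p 0 < q 0 → q 0 < r 0 →
      (p 1 - q 1) * (r 0 - q 0) < (q 1 - r 1) * (q 0 - p 0)) :
    (stepsOf l).IsChain slopeLt := by
  induction l with
  | nil => simp [stepsOf]
  | cons p l ih =>
    match l, ih with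
    | [], _ => simp [stepsOf]
    | [q], _ => simp [stepsOf]
    | q :: r :: l, ih =>
      have ih' := ih hl.tail (fun p hp q hq r hr => hc p (List.mem_cons_of_mem _ hp) q
        (List.mem_cons_of_mem _ hq) r (List.mem_cons_of_mem _ hr))
      simp only [stepsOf] at ih' ⊢
      rw [List.isChain_cons_cons]
      refine ⟨?_, ih'⟩
      have hpq : chainLt p q := by
        rw [List.pairwise_cons] at hl; exact hl.1 q (by simp)
      have hqr : chainLt q r := by
        have := hl.tail
        rw [List.tail_cons, List.pairwise_cons] at this; exact this.1 r (by simp)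
      have := hc p (by simp) q (by simp) r (by simp) hpq.1 hqr.1
      unfold chainLt at hpq hqr
      unfold slopeLt stepOf
      refine ⟨by simp only; omega, by simp only; omega, by simp only; omega, by simp only; omega, ?_⟩
      zify
      rw [Int.toNat_of_nonneg (by omega), Int.toNat_of_nonneg (by omega),
        Int.toNat_of_nonneg (by omega), Int.toNat_of_nonneg (by omega)]
      exact this

lemma stepsOf_pos (l : List (Fin 2 → ℤ)) (hl : l.Pairwise chainLt) :
    ∀ d ∈ stepsOf l, 1 ≤ d.1 ∧ 1 ≤ d.2 := by
  induction l with
  | nil => simp [stepsOf]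
  | cons p l ih =>
    match l, ih with
    | [], _ => simp [stepsOf]
    | q :: l, ih =>
      intro d hd
      simp only [stepsOf, List.mem_cons] at hd
      rcases hd with rfl | hd
      · have hpq : chainLt p q := by
          rw [List.pairwise_cons] at hl; exact hl.1 q (by simp)
        unfold chainLt at hpq
        unfold stepOf
        constructor <;> simp only <;> omega
      · exact ih hl.tail d hd

lemma stepsOf_sum (a b : ℤ) (l : List (Fin 2 → ℤ)) (hl : l.Pairwise chainLt) (p : Fin 2 → ℤ)
    (hp : l.head? = some p) (hb : ∀ z ∈ l, z 0 ≤ a ∧ -b ≤ z 1) :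
    (((stepsOf l).map Prod.fst).sum : ℤ) ≤ a - p 0 ∧
    (((stepsOf l).map Prod.snd).sum : ℤ) ≤ p 1 + b := by
  induction l generalizing p with
  | nil => simp at hp
  | cons p' l ih =>
    simp only [List.head?_cons, Option.some.injEq] at hp
    subst hp
    match l, ih with
    | [], _ =>
      have := hb p' (by simp)
      simp [stepsOf]; omega
    | q :: l, ih =>
      have hpq : chainLt p' q := by
        rw [List.pairwise_cons] at hl; exact hl.1 q (by simp)
      have := ih hl.tail q (by simp) (fun z hz => hb z (List.mem_cons_of_mem _ hz))
      unfold chainLt at hpq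
      simp only [stepsOf, List.map_cons, List.sum_cons, stepOf]
      push_cast at this ⊢
      omega

lemma stepsOf_inj (l l' : List (Fin 2 → ℤ)) (hl : l.Pairwise chainLt) (hl' : l'.Pairwise chainLt)
    (hh : l.head? = l'.head?) (hs : stepsOf l = stepsOf l') : l = l' := by
  induction l generalizing l' with
  | nil => cases l' with
    | nil => rfl
    | cons => simp at hh
  | cons p l ih =>
    cases l' with
    | nil => simp at hh
    | cons p' l' =>
      simp only [List.head?_cons, Option.some.injEq] at hh
      subst hh
      match l, l', ih with
      | [], [], _ => rfl
      | [], _ :: _, _ => simp [stepsOf] at hs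
      | _ :: _, [], _ => simp [stepsOf] at hs
      | q :: l, q' :: l', ih =>
        simp only [stepsOf, List.cons.injEq] at hs
        have hpq : chainLt p q := by
          rw [List.pairwise_cons] at hl; exact hl.1 q (by simp)
        have hpq' : chainLt p q' := by
          rw [List.pairwise_cons] at hl'; exact hl'.1 q' (by simp)
        have e : q = q' := by
          have := hs.1
          simp only [stepOf, Prod.mk.injEq] at this
          unfold chainLt at hpq hpq'
          ext i; fin_cases i <;> simp only [Fin.zero_eta, Fin.mk_one] <;> omega
        subst e
        rw [ih (q :: l') hl.tail hl'.tail (by simp) hs.2]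

/-- The symmetric integer box. -/
def ibox (a b : ℕ) : Finset (Fin 2 → ℤ) := Finset.Icc ![-(a : ℤ), -(b : ℤ)] ![(a : ℤ), (b : ℤ)]

lemma mem_ibox {a b : ℕ} {z : Fin 2 → ℤ} :
    z ∈ ibox a b ↔ |z 0| ≤ a ∧ |z 1| ≤ b := by
  simp only [ibox, Finset.mem_Icc, Pi.le_def, Fin.forall_fin_two, abs_le]
  simp; tauto

lemma card_ibox (a b : ℕ) : (ibox a b).card = (2 * a + 1) * (2 * b + 1) := by
  simp [ibox, Pi.card_Icc]
  congr 1 <;> omega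

open Classical in
/-- All chains inside the box. -/
def chainsIn (a b : ℕ) : Finset (Finset (Fin 2 → ℤ)) := (ibox a b).powerset.filter NEChain

open Classical in
lemma card_chainsIn_le (a b : ℕ) :
    (chainsIn a b).card ≤ 1 + ((2 * a + 1) * (2 * b + 1)) * (stepSets (2 * a) (2 * b)).card := by
  have h1 : ((chainsIn a b).erase ∅).card ≤ (ibox a b ×ˢ stepSets (2 * a) (2 * b)).card := by
    have hex : ∀ U : Finset (Fin 2 → ℤ), ∃ l : List (Fin 2 → ℤ), NEChain U →
        l.toFinset = U ∧ l.Pairwise chainLt := by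
      intro U
      by_cases h : NEChain U
      · obtain ⟨l, hl⟩ := h.exists_list
        exact ⟨l, fun _ => hl⟩
      · exact ⟨[], fun h' => absurd h' h⟩
    choose f hf using hex
    apply Finset.card_le_card_of_injOn (fun U => ((f U).head?.getD 0, (stepsOf (f U)).toFinset))
    · intro U hU
      simp only [Finset.coe_erase, Set.mem_sdiff, Finset.mem_coe, Set.mem_singleton_iff, chainsIn,
        Finset.mem_filter, Finset.mem_powerset] at hU
      obtain ⟨⟨hbox, hch⟩, hne⟩ := hU
      obtain ⟨e, hp⟩ := hf U hch
      have hmem : ∀ z ∈ f U, z ∈ U := by intro z hz; rw [← e]; simpa using hz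
      have hnn : f U ≠ [] := by
        intro h; rw [h] at e; simp at e; exact hne e.symm
      obtain ⟨p, hhead⟩ : ∃ p, (f U).head? = some p := by
        cases hfu : f U with
        | nil => exact absurd hfu hnn
        | cons p l => exact ⟨p, rfl⟩
      have hpU : p ∈ U := hmem p (List.mem_of_mem_head? hhead)
      have hpb := mem_ibox.1 (hbox hpU)
      rw [abs_le, abs_le] at hpb
      have hsum := stepsOf_sum a b (f U) hp p hhead (by
        intro z hz
        have := mem_ibox.1 (hbox (hmem z hz))
        rw [abs_le, abs_le] at this
        omega)
      have hnd : (stepsOf (f U)).Nodup := by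
        have := (stepsOf_chain (f U) hp (fun p hp q hq r hr => hch.2 p (hmem p hp) q (hmem q hq) r (hmem r hr))).pairwise
        refine this.imp ?_
        rintro d e h rfl
        exact slopeLt_asymm _ _ h h
      have s1 : ∑ d ∈ (stepsOf (f U)).toFinset, d.1 ≤ 2 * a := by
        rw [List.sum_toFinset _ hnd]
        have := hsum.1
        change (List.map Prod.fst (stepsOf (f U))).sum ≤ _
        omega
      have s2 : ∑ d ∈ (stepsOf (f U)).toFinset, d.2 ≤ 2 * b := by
        rw [List.sum_toFinset _ hnd]
        have := hsum.2
        change (List.map Prod.snd (stepsOf (f U))).sum ≤ _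
        omega
      simp only [Finset.coe_product, Set.mem_prod, Finset.mem_coe, hhead, Option.getD_some]
      refine ⟨hbox hpU, ?_⟩
      simp only [stepSets, Finset.mem_filter, Finset.mem_powerset]
      refine ⟨?_, s1, s2⟩
      intro d hd
      have hpos := stepsOf_pos (f U) hp d (by simpa using hd)
      have t1 := Finset.single_le_sum (f := fun d : ℕ × ℕ => d.1) (fun _ _ => Nat.zero_le _) hd
      have t2 := Finset.single_le_sum (f := fun d : ℕ × ℕ => d.2) (fun _ _ => Nat.zero_le _) hd
      simp only [Finset.mem_product, Finset.mem_Icc]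
      omega
    · intro U hU U' hU' heq
      simp only [Finset.coe_erase, Set.mem_sdiff, Finset.mem_coe, Set.mem_singleton_iff, chainsIn,
        Finset.mem_filter, Finset.mem_powerset] at hU hU'
      obtain ⟨⟨hbox, hch⟩, hne⟩ := hU
      obtain ⟨⟨hbox', hch'⟩, hne'⟩ := hU'
      obtain ⟨e, hp⟩ := hf U hch
      obtain ⟨e', hp'⟩ := hf U' hch'
      have hmem : ∀ z ∈ f U, z ∈ U := by intro z hz; rw [← e]; simpa using hz
      have hmem' : ∀ z ∈ f U', z ∈ U' := by intro z hz; rw [← e']; simpa using hz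
      have c1 := (stepsOf_chain (f U) hp (fun p hp q hq r hr => hch.2 p (hmem p hp) q (hmem q hq) r (hmem r hr))).pairwise
      have c2 := (stepsOf_chain (f U') hp' (fun p hp q hq r hr => hch'.2 p (hmem' p hp) q (hmem' q hq) r (hmem' r hr))).pairwise
      have n1 : (stepsOf (f U)).Nodup := c1.imp (by rintro d e h rfl; exact slopeLt_asymm _ _ h h)
      have n2 : (stepsOf (f U')).Nodup := c2.imp (by rintro d e h rfl; exact slopeLt_asymm _ _ h h)
      simp only [Prod.mk.injEq] at heq
      have hperm := List.perm_of_nodup_nodup_toFinset_eq n1 n2 heq.2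
      have hst : stepsOf (f U) = stepsOf (f U') := by
        refine List.Perm.eq_of_pairwise ?_ c1 c2 hperm
        intro x y _ _ h h'
        exact (slopeLt_asymm _ _ h h').elim
      have hhead : (f U).head? = (f U').head? := by
        have h1 := heq.1
        cases hfu : f U with
        | nil => rw [hfu] at e; simp at e; exact absurd e.symm hne
        | cons p l =>
          cases hfu' : f U' with
          | nil => rw [hfu'] at e'; simp at e'; exact absurd e'.symm hne'
          | cons p' l' => rw [hfu, hfu'] at h1; simpa using h1
      rw [← e, ← e', stepsOf_inj _ _ hp hp' hhead hst]
  rw [Finset.card_product, card_ibox] at h1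
  have := Finset.pred_card_le_card_erase (s := chainsIn a b) (a := ∅)
  omega


lemma NEChain_of_exposed (U : Finset (Fin 2 → ℤ))
    (h : ∀ q ∈ U, ∃ α β : ℝ, 0 ≤ α ∧ 0 ≤ β ∧ ∀ p ∈ U, p ≠ q →
      α * (p 0 : ℝ) + β * (p 1 : ℝ) < α * (q 0 : ℝ) + β * (q 1 : ℝ)) : NEChain U := by
  have h1 : ∀ p ∈ U, ∀ q ∈ U, p ≠ q → (p 0 < q 0 ∧ q 1 < p 1) ∨ (q 0 < p 0 ∧ p 1 < q 1) := by
    intro p hp q hq hne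
    obtain ⟨α, β, ha, hb, h1⟩ := h q hq
    obtain ⟨α', β', ha', hb', h2⟩ := h p hp
    have h1 := h1 p hp hne
    have h2 := h2 q hq hne.symm
    have k1 : p 0 < q 0 ∨ p 1 < q 1 := by
      by_contra hcon
      push Not at hcon
      have e1 : (q 0 : ℝ) ≤ p 0 := by exact_mod_cast hcon.1
      have e2 : (q 1 : ℝ) ≤ p 1 := by exact_mod_cast hcon.2
      nlinarith [mul_le_mul_of_nonneg_left e1 ha, mul_le_mul_of_nonneg_left e2 hb]
    have k2 : q 0 < p 0 ∨ q 1 < p 1 := by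
      by_contra hcon
      push Not at hcon
      have e1 : (p 0 : ℝ) ≤ q 0 := by exact_mod_cast hcon.1
      have e2 : (p 1 : ℝ) ≤ q 1 := by exact_mod_cast hcon.2
      nlinarith [mul_le_mul_of_nonneg_left e1 ha', mul_le_mul_of_nonneg_left e2 hb']
    omega
  refine ⟨h1, ?_⟩
  intro p hp q hq r hr hpq hqr
  have g1 := h1 p hp q hq (by rintro rfl; omega)
  have g2 := h1 q hq r hr (by rintro rfl; omega)
  obtain ⟨α, β, ha, hb, h3⟩ := h q hq
  have h4 := h3 p hp (by rintro rfl; omega)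
  have h5 := h3 r hr (by rintro rfl; omega)
  have dx1 : (0 : ℝ) < q 0 - p 0 := by rw [sub_pos]; exact_mod_cast hpq
  have dx2 : (0 : ℝ) < r 0 - q 0 := by rw [sub_pos]; exact_mod_cast hqr
  have dy1 : (0 : ℝ) < p 1 - q 1 := by rw [sub_pos]; norm_cast; omega
  have dy2 : (0 : ℝ) < q 1 - r 1 := by rw [sub_pos]; norm_cast; omega
  have e1 : β * (p 1 - q 1 : ℝ) < α * (q 0 - p 0) := by linarith
  have e2 : α * (r 0 - q 0 : ℝ) < β * (q 1 - r 1) := by linarith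
  have hbp : 0 < β := by
    rcases hb.lt_or_eq with hb | hb
    · exact hb
    · rw [← hb] at e2; have := mul_nonneg ha dx2.le; linarith
  have : β * ((p 1 - q 1 : ℝ) * (r 0 - q 0)) < β * ((q 1 - r 1) * (q 0 - p 0)) := by
    nlinarith [mul_lt_mul_of_pos_right e1 dx2, mul_lt_mul_of_pos_right e2 dx1]
  have := lt_of_mul_lt_mul_left this hb
  exact_mod_cast this

/-- Convexly independent finite lattice sets. -/
def ConvIndep (V : Finset (Fin 2 → ℤ)) : Prop :=
  ∀ v ∈ V, intVec v ∉ convexHull ℝ (intVec '' ((V : Set (Fin 2 → ℤ)) \ {v}))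

/-- Sign of a boolean. -/
def sgB (b : Bool) : ℤ := if b then 1 else -1

lemma sgB_mul_self (b : Bool) : sgB b * sgB b = 1 := by cases b <;> simp [sgB]
lemma sgB_abs (b : Bool) : |sgB b| = 1 := by cases b <;> simp [sgB]

/-- Coordinate reflection. -/
def reflB (s : Bool × Bool) (z : Fin 2 → ℤ) : Fin 2 → ℤ := ![sgB s.1 * z 0, sgB s.2 * z 1]

lemma reflB_reflB (s : Bool × Bool) (z : Fin 2 → ℤ) : reflB s (reflB s z) = z := by
  ext i
  fin_cases i <;> simp [reflB, ← mul_assoc, sgB_mul_self]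

open Classical in
/-- The (reflected) part of `V` exposed in a given quadrant. -/
def quadU (V : Finset (Fin 2 → ℤ)) (s : Bool × Bool) : Finset (Fin 2 → ℤ) :=
  (V.filter (fun v => ∃ α β : ℝ, 0 ≤ α ∧ 0 ≤ β ∧ ∀ u ∈ V, u ≠ v →
    α * (reflB s u 0 : ℝ) + β * (reflB s u 1 : ℝ) <
      α * (reflB s v 0 : ℝ) + β * (reflB s v 1 : ℝ))).image (reflB s)

lemma quadU_mem (V : Finset (Fin 2 → ℤ)) (s : Bool × Bool) (a b : ℕ) (hV : V ⊆ ibox a b) :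
    quadU V s ∈ chainsIn a b := by
  classical
  simp only [chainsIn, Finset.mem_filter, Finset.mem_powerset]
  constructor
  · intro z hz
    simp only [quadU, Finset.mem_image, Finset.mem_filter] at hz
    obtain ⟨v, ⟨hv, -⟩, rfl⟩ := hz
    have := mem_ibox.1 (hV hv)
    rw [mem_ibox]
    simpa [reflB, abs_mul, sgB_abs] using this
  · apply NEChain_of_exposed
    intro q hq
    simp only [quadU, Finset.mem_image, Finset.mem_filter] at hq
    obtain ⟨v, ⟨hv, α, β, ha, hb, h⟩, rfl⟩ := hq
    refine ⟨α, β, ha, hb, ?_⟩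
    intro p hp hne
    simp only [quadU, Finset.mem_image, Finset.mem_filter] at hp
    obtain ⟨u, ⟨hu, -⟩, rfl⟩ := hp
    exact h u hu (by rintro rfl; exact hne rfl)

lemma ConvIndep.mem_iff {V : Finset (Fin 2 → ℤ)} (h : ConvIndep V) (v : Fin 2 → ℤ) :
    v ∈ V ↔ ∃ s, reflB s v ∈ quadU V s := by
  classical
  constructor
  · intro hv
    have hfin : (intVec '' ((V : Set (Fin 2 → ℤ)) \ {v})).Finite :=
      ((V.finite_toSet).subset Set.diff_subset).image _
    obtain ⟨f, t, h1, h2⟩ := geometric_hahn_banach_closed_point (convex_convexHull ℝ _)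
      (hfin.isCompact_convexHull (𝕜 := ℝ)).isClosed (h v hv)
    have hf : ∀ z : Fin 2 → ℝ, f z = f ![1, 0] * z 0 + f ![0, 1] * z 1 := by
      intro z
      have : z = z 0 • ![1, 0] + z 1 • ![0, 1] := by
        ext i; fin_cases i <;> simp
      conv_lhs => rw [this]
      rw [map_add, map_smul, map_smul, smul_eq_mul, smul_eq_mul]; ring
    have key : ∀ u ∈ V, u ≠ v →
        f ![1, 0] * (u 0 : ℝ) + f ![0, 1] * (u 1 : ℝ) < f ![1, 0] * (v 0 : ℝ) + f ![0, 1] * (v 1 : ℝ) := by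
      intro u hu hne
      have := (h1 (intVec u) (subset_convexHull ℝ _ ⟨u, ⟨hu, hne⟩, rfl⟩)).trans h2
      rw [hf (intVec u), hf (intVec v)] at this
      exact this
    set α := f ![1, 0]
    set β := f ![0, 1]
    refine ⟨(decide (0 ≤ α), decide (0 ≤ β)), ?_⟩
    simp only [quadU, Finset.mem_image, Finset.mem_filter]
    refine ⟨v, ⟨hv, |α|, |β|, abs_nonneg _, abs_nonneg _, ?_⟩, rfl⟩
    intro u hu hne
    have := key u hu hne
    have e1 : ∀ (x : ℝ) (n : ℤ), |x| * ((sgB (decide (0 ≤ x)) * n : ℤ) : ℝ) = x * n := by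
      intro x n
      by_cases hx : 0 ≤ x
      · simp [sgB, hx, abs_of_nonneg hx]
      · simp [sgB, hx, abs_of_neg (not_le.1 hx)]
    simp only [reflB, Matrix.cons_val_zero, Matrix.cons_val_one, e1]
    exact this
  · rintro ⟨s, hs⟩
    simp only [quadU, Finset.mem_image, Finset.mem_filter] at hs
    obtain ⟨u, ⟨hu, -⟩, e⟩ := hs
    have := congrArg (reflB s) e
    rw [reflB_reflB, reflB_reflB] at this
    rwa [← this]

open Classical in
/-- Convexly independent sets in the box. -/
def indepIn (a b : ℕ) : Finset (Finset (Fin 2 → ℤ)) := (ibox a b).powerset.filter ConvIndep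

lemma card_indepIn_le (a b : ℕ) : (indepIn a b).card ≤ (chainsIn a b).card ^ 4 := by
  classical
  have : (Fintype.piFinset (fun _ : Bool × Bool => chainsIn a b)).card = (chainsIn a b).card ^ 4 := by
    simp
  rw [← this]
  apply Finset.card_le_card_of_injOn quadU
  · intro V hV
    simp only [indepIn, Finset.coe_filter, Finset.mem_powerset, Set.mem_setOf_eq] at hV
    simp only [Finset.mem_coe, Fintype.mem_piFinset]
    intro s
    exact quadU_mem V s a b hV.1
  · intro V hV V' hV' e
    simp only [indepIn, Finset.coe_filter, Finset.mem_powerset, Set.mem_setOf_eq] at hV hV'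
    ext v
    rw [hV.2.mem_iff, hV'.2.mem_iff, e]

lemma exists_convIndep (V : Finset (Fin 2 → ℤ)) : ∃ V' ⊆ V, ConvIndep V' ∧
    convexHull ℝ (intVec '' (V' : Set (Fin 2 → ℤ))) = convexHull ℝ (intVec '' (V : Set (Fin 2 → ℤ))) := by
  classical
  induction V using Finset.strongInduction with
  | H V ih =>
    by_cases h : ConvIndep V
    · exact ⟨V, subset_rfl, h, rfl⟩
    · unfold ConvIndep at h
      push Not at h
      obtain ⟨v, hv, hmem⟩ := h
      obtain ⟨V', h1, h2, h3⟩ := ih (V.erase v) (Finset.erase_ssubset hv)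
      refine ⟨V', h1.trans (Finset.erase_subset _ _), h2, h3.trans ?_⟩
      rw [Finset.coe_erase]
      apply subset_antisymm
      · exact convexHull_mono (Set.image_mono Set.diff_subset)
      · apply convexHull_min _ (convex_convexHull ℝ _)
        rintro _ ⟨u, hu, rfl⟩
        by_cases huv : u = v
        · rw [huv]; exact hmem
        · exact subset_convexHull ℝ _ ⟨u, ⟨hu, huv⟩, rfl⟩


/-- 2x2 determinant. -/
def det2 (u v : Fin 2 → ℤ) : ℤ := u 0 * v 1 - u 1 * v 0

lemma card_quot (u v : Fin 2 → ℤ) (hD : det2 u v ≠ 0) :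
    ∃ N : Submodule ℤ (Fin 2 → ℤ), (∀ i j : ℤ, i • u + j • v ∈ N) ∧
      Nat.card ((Fin 2 → ℤ) ⧸ N) = (det2 u v).natAbs := by
  set A : Matrix (Fin 2) (Fin 2) ℤ := !![u 0, v 0; u 1, v 1] with hA
  have hdet : A.det = det2 u v := by
    rw [Matrix.det_fin_two_of, det2]; ring
  set φ := Matrix.toLin' A
  have hinj : Function.Injective φ := by
    apply Matrix.mulVec_injective_of_det_ne_zero
    rw [hdet]; exact hD
  refine ⟨LinearMap.range φ, ?_, ?_⟩
  · intro i j
    refine ⟨![i, j], ?_⟩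
    ext k
    fin_cases k <;> simp [φ, A, Matrix.mulVec, dotProduct, Fin.sum_univ_two] <;> ring
  · have := Submodule.natAbs_det_equiv (LinearMap.range φ) (LinearEquiv.ofInjective φ hinj)
    rw [← this]
    have e : (LinearMap.range φ).subtype ∘ₗ AddMonoidHom.toIntLinearMap
      (((LinearEquiv.ofInjective φ hinj : (Fin 2 → ℤ) ≃ₗ[ℤ] LinearMap.range φ) : (Fin 2 → ℤ) →+ LinearMap.range φ)) = φ := by
      ext; rfl
    rw [e, LinearMap.det_toLin', hdet]

lemma tri_count (u v : Fin 2 → ℤ) (hD : 0 < det2 u v) (S : Finset (Fin 2 → ℤ))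
    (hS : ∀ z, 0 ≤ det2 z v → 0 ≤ det2 u z → det2 z v + det2 u z ≤ det2 u v → z ∈ S) :
    det2 u v ≤ 2 * S.card := by
  classical
  obtain ⟨N, hN, hcard⟩ := card_quot u v hD.ne'
  set D := det2 u v with hDdef
  set f : (Fin 2 → ℤ) ⧸ N → (Fin 2 → ℤ) := fun q =>
    q.out - (det2 q.out v / D) • u - (det2 u q.out / D) • v with hf
  have hfinj : Function.Injective f := by
    intro q q' h
    have e : q.out - q'.out = (det2 q.out v / D - det2 q'.out v / D) • u +
        (det2 u q.out / D - det2 u q'.out / D) • v := by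
      simp only [hf] at h
      rw [sub_smul, sub_smul]
      linear_combination (exp := 1) h
    have : q.out - q'.out ∈ N := by rw [e]; exact hN _ _
    rw [← Submodule.Quotient.eq] at this
    simpa [Submodule.Quotient.mk] using this
  set S' := S ∪ S.image (fun z => u + v - z) with hS'
  have hmem : ∀ q, f q ∈ S' := by
    intro q
    have e1 : det2 (f q) v = det2 q.out v % D := by
      rw [Int.emod_def]
      simp only [hf, det2, Pi.sub_apply, Pi.smul_apply, smul_eq_mul]
      rw [hDdef]; simp only [det2]; ring
    have e2 : det2 u (f q) = det2 u q.out % D := by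
      rw [Int.emod_def]
      simp only [hf, det2, Pi.sub_apply, Pi.smul_apply, smul_eq_mul]
      rw [hDdef]; simp only [det2]; ring
    have a1 := Int.emod_nonneg (det2 q.out v) hD.ne'
    have a2 := Int.emod_nonneg (det2 u q.out) hD.ne'
    have a3 := Int.emod_lt_of_pos (det2 q.out v) hD
    have a4 := Int.emod_lt_of_pos (det2 u q.out) hD
    rw [← e1] at a1 a3
    rw [← e2] at a2 a4
    rw [hS', Finset.mem_union]
    by_cases hle : det2 (f q) v + det2 u (f q) ≤ D
    · left; exact hS _ a1 a2 hle
    · right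
      rw [Finset.mem_image]
      refine ⟨u + v - f q, ?_, by abel⟩
      have e3 : det2 (u + v - f q) v = D - det2 (f q) v := by
        rw [hDdef]; simp only [det2, Pi.sub_apply, Pi.add_apply]; ring
      have e4 : det2 u (u + v - f q) = D - det2 u (f q) := by
        rw [hDdef]; simp only [det2, Pi.sub_apply, Pi.add_apply]; ring
      apply hS
      · rw [e3]; linarith
      · rw [e4]; linarith
      · rw [e3, e4]; linarith
  have hle : Nat.card ((Fin 2 → ℤ) ⧸ N) ≤ S'.card := by
    have := Nat.card_le_card_of_injective (fun q => (⟨f q, hmem q⟩ : S')) (by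
      intro q q' h
      exact hfinj (by simpa using h))
    simpa using this
  have h2 : S'.card ≤ S.card + S.card := by
    refine (Finset.card_union_le _ _).trans ?_
    have := Finset.card_image_le (s := S) (f := fun z => u + v - z)
    omega
  rw [hcard] at hle
  omega

/-- Gauss reduction of the rows. -/
lemma gauss (u v : Fin 2 → ℤ) : ∃ a b c d : ℤ, a * d - b * c = 1 ∧
    3 * (((a * u 0 + b * u 1) ^ 2 + (a * v 0 + b * v 1) ^ 2) *
      ((c * u 0 + d * u 1) ^ 2 + (c * v 0 + d * v 1) ^ 2)) ≤ 4 * (det2 u v) ^ 2 := by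
  set F : ℤ → ℤ → ℤ → ℤ → ℕ := fun a b c d =>
    (((a * u 0 + b * u 1) ^ 2 + (a * v 0 + b * v 1) ^ 2) +
      ((c * u 0 + d * u 1) ^ 2 + (c * v 0 + d * v 1) ^ 2)).toNat with hF
  have hex : ∃ n : ℕ, ∃ a b c d : ℤ, a * d - b * c = 1 ∧ F a b c d = n :=
    ⟨_, 1, 0, 0, 1, by norm_num, rfl⟩
  classical
  obtain ⟨a, b, c, d, hdet, hmin⟩ := Nat.find_spec hex
  refine ⟨a, b, c, d, hdet, ?_⟩
  have hle : ∀ a' b' c' d' : ℤ, a' * d' - b' * c' = 1 →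
      (((a * u 0 + b * u 1) ^ 2 + (a * v 0 + b * v 1) ^ 2) +
      ((c * u 0 + d * u 1) ^ 2 + (c * v 0 + d * v 1) ^ 2)) ≤
      (((a' * u 0 + b' * u 1) ^ 2 + (a' * v 0 + b' * v 1) ^ 2) +
      ((c' * u 0 + d' * u 1) ^ 2 + (c' * v 0 + d' * v 1) ^ 2)) := by
    intro a' b' c' d' h
    have := Nat.find_min' hex ⟨a', b', c', d', h, rfl⟩
    rw [← hmin] at this
    simp only [hF] at this
    rw [Int.toNat_le, Int.toNat_of_nonneg (by positivity)] at this
    exact this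
  have k1 := hle a b (c + a) (d + b) (by linear_combination hdet)
  have k2 := hle a b (c - a) (d - b) (by linear_combination hdet)
  have k3 := hle (a + c) (b + d) c d (by linear_combination hdet)
  have k4 := hle (a - c) (b - d) c d (by linear_combination hdet)
  have hD : det2 u v = (a * u 0 + b * u 1) * (c * v 0 + d * v 1) -
      (c * u 0 + d * u 1) * (a * v 0 + b * v 1) := by
    simp only [det2]
    linear_combination (-(u 0 * v 1 - u 1 * v 0)) * hdet
  rw [hD]
  have r1 : (c + a) * u 0 + (d + b) * u 1 = (c * u 0 + d * u 1) + (a * u 0 + b * u 1) := by ring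
  have r2 : (c + a) * v 0 + (d + b) * v 1 = (c * v 0 + d * v 1) + (a * v 0 + b * v 1) := by ring
  have r3 : (c - a) * u 0 + (d - b) * u 1 = (c * u 0 + d * u 1) - (a * u 0 + b * u 1) := by ring
  have r4 : (c - a) * v 0 + (d - b) * v 1 = (c * v 0 + d * v 1) - (a * v 0 + b * v 1) := by ring
  have r5 : (a + c) * u 0 + (b + d) * u 1 = (a * u 0 + b * u 1) + (c * u 0 + d * u 1) := by ring
  have r6 : (a + c) * v 0 + (b + d) * v 1 = (a * v 0 + b * v 1) + (c * v 0 + d * v 1) := by ring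
  have r7 : (a - c) * u 0 + (b - d) * u 1 = (a * u 0 + b * u 1) - (c * u 0 + d * u 1) := by ring
  have r8 : (a - c) * v 0 + (b - d) * v 1 = (a * v 0 + b * v 1) - (c * v 0 + d * v 1) := by ring
  rw [r1, r2] at k1
  rw [r3, r4] at k2
  rw [r5, r6] at k3
  rw [r7, r8] at k4
  generalize a * u 0 + b * u 1 = x at *
  generalize a * v 0 + b * v 1 = y at *
  generalize c * u 0 + d * u 1 = z at *
  generalize c * v 0 + d * v 1 = t at *
  have m1 : |2 * (x * z + y * t)| ≤ x ^ 2 + y ^ 2 := by rw [abs_le]; constructor <;> linarith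
  have m2 : |2 * (x * z + y * t)| ≤ z ^ 2 + t ^ 2 := by rw [abs_le]; constructor <;> linarith
  have m3 := mul_le_mul m1 m2 (abs_nonneg _) (by positivity)
  rw [abs_mul_abs_self] at m3
  linarith


lemma LatticeEquiv.symm' {d : ℕ} {P Q : Set (Fin d → ℝ)} (h : LatticeEquiv d P Q) :
    LatticeEquiv d Q P := by
  obtain ⟨σ, h1, h2⟩ := h
  refine ⟨σ.symm, ?_, ?_⟩
  · conv_lhs => rw [← h1]
    rw [Set.image_image]; simp
  · rw [h2, Set.image_image]; simp

lemma LatticeEquiv.trans' {d : ℕ} {P Q R : Set (Fin d → ℝ)} (h : LatticeEquiv d P Q)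
    (h' : LatticeEquiv d Q R) : LatticeEquiv d P R := by
  obtain ⟨σ, h1, h2⟩ := h
  obtain ⟨τ, h3, h4⟩ := h'
  refine ⟨σ.trans τ, ?_, ?_⟩
  · rw [AffineEquiv.coe_trans, Set.image_comp, h1, h3]
  · rw [AffineEquiv.coe_trans, Set.image_comp, ← h2, h4]

lemma LatticeEquiv.refl' {d : ℕ} (P : Set (Fin d → ℝ)) : LatticeEquiv d P P :=
  ⟨AffineEquiv.refl ℝ _, by simp, by simp⟩

/-- Integer unimodular linear map. -/
def uniLin (a b c d : ℤ) (h : a * d - b * c = 1) : (Fin 2 → ℝ) ≃ₗ[ℝ] (Fin 2 → ℝ) where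
  toFun z := ![a * z 0 + b * z 1, c * z 0 + d * z 1]
  invFun z := ![d * z 0 - b * z 1, -c * z 0 + a * z 1]
  map_add' x y := by ext i; fin_cases i <;> simp <;> ring
  map_smul' x y := by ext i; fin_cases i <;> simp <;> ring
  left_inv z := by
    have h' : (a : ℝ) * d - b * c = 1 := by exact_mod_cast h
    ext i; fin_cases i <;> simp
    · linear_combination (z 0) * h'
    · linear_combination (z 1) * h'
  right_inv z := by
    have h' : (a : ℝ) * d - b * c = 1 := by exact_mod_cast h
    ext i; fin_cases i <;> simp
    · linear_combination (z 0) * h'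
    · linear_combination (z 1) * h'

/-- Integer unimodular affine map sending `p` to `0`. -/
def uniAff (a b c d : ℤ) (h : a * d - b * c = 1) (p : Fin 2 → ℤ) :
    (Fin 2 → ℝ) ≃ᵃ[ℝ] (Fin 2 → ℝ) :=
  (AffineEquiv.constVAdd ℝ (Fin 2 → ℝ) (-(intVec p))).trans (uniLin a b c d h).toAffineEquiv

lemma uniAff_intVec (a b c d : ℤ) (h : a * d - b * c = 1) (p z : Fin 2 → ℤ) :
    uniAff a b c d h p (intVec z) =
      intVec ![a * (z 0 - p 0) + b * (z 1 - p 1), c * (z 0 - p 0) + d * (z 1 - p 1)] := by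
  ext i
  fin_cases i <;> simp [uniAff, uniLin, intVec] <;> ring

lemma uniAff_lattice (a b c d : ℤ) (h : a * d - b * c = 1) (p : Fin 2 → ℤ) :
    uniAff a b c d h p '' latticeSet 2 = latticeSet 2 := by
  apply subset_antisymm
  · rintro _ ⟨_, ⟨z, rfl⟩, rfl⟩
    rw [uniAff_intVec]; exact ⟨_, rfl⟩
  · rintro _ ⟨z, rfl⟩
    refine ⟨intVec ![d * z 0 - b * z 1 + p 0, -c * z 0 + a * z 1 + p 1], ⟨_, rfl⟩, ?_⟩
    rw [uniAff_intVec]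
    congr 1
    ext i; fin_cases i <;> simp
    · linear_combination (z 0) * h
    · linear_combination (z 1) * h

lemma functional_zero (S : Set (Fin 2 → ℝ)) (hS : affineSpan ℝ S = ⊤) (c0 c1 k : ℝ)
    (h : ∀ z ∈ S, c0 * z 0 + c1 * z 1 = k) : c0 = 0 ∧ c1 = 0 := by
  set ℓ : (Fin 2 → ℝ) →ₗ[ℝ] ℝ := c0 • LinearMap.proj 0 + c1 • LinearMap.proj 1 with hl
  have e := AffineMap.ext_on (f := ℓ.toAffineMap) (g := AffineMap.const ℝ _ k) hS (by
    intro z hz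
    simp [hl, h z hz])
  have e0 := congrArg (fun f => f (0 : Fin 2 → ℝ)) e
  have e1 := congrArg (fun f => f (![1, 0] : Fin 2 → ℝ)) e
  have e2 := congrArg (fun f => f (![0, 1] : Fin 2 → ℝ)) e
  simp [hl] at e0 e1 e2
  constructor <;> linarith

lemma exists_det_ne (V : Set (Fin 2 → ℤ)) (hS : affineSpan ℝ (intVec '' V) = ⊤) :
    ∃ p ∈ V, ∃ q ∈ V, ∃ r ∈ V, det2 (q - p) (r - p) ≠ 0 := by
  by_contra hcon
  push Not at hcon
  obtain ⟨p, hp⟩ : V.Nonempty := by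
    by_contra hne
    rw [Set.not_nonempty_iff_eq_empty] at hne
    have := functional_zero _ hS 1 0 0 (by rw [hne]; simp)
    simp at this
  obtain ⟨q, hq, hne⟩ : ∃ q ∈ V, q 0 ≠ p 0 := by
    by_contra hall
    push Not at hall
    have := functional_zero _ hS 1 0 (p 0) (by
      rintro _ ⟨z, hz, rfl⟩
      simp [intVec, hall z hz])
    simp at this
  have := functional_zero _ hS (-((q 1 : ℝ) - p 1)) ((q 0 : ℝ) - p 0)
    (-((q 1 : ℝ) - p 1) * p 0 + ((q 0 : ℝ) - p 0) * p 1) (by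
      rintro _ ⟨z, hz, rfl⟩
      have h := hcon p hp q hq z hz
      have h' : (((q 0 : ℝ) - p 0) * (z 1 - p 1) - (q 1 - p 1) * (z 0 - p 0)) = 0 := by
        have : ((det2 (q - p) (z - p) : ℤ) : ℝ) = 0 := by exact_mod_cast h
        simpa [det2] using this
      simp only [intVec]
      linarith)
  have h2 : (q 0 : ℝ) = p 0 := by linarith [this.2]
  exact hne (by exact_mod_cast h2)

lemma polygon_normalize (P : Set (Fin 2 → ℝ)) (w : ℕ) (hw : 1 ≤ w) (hP : IsConvexLatticePolytope 2 P)
    (hf : IsFullDim 2 P) (hcard : (latticePts 2 P).ncard = w) :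
    ∃ a b : ℕ, 1 ≤ a ∧ 1 ≤ b ∧ a * b ≤ 6 * w ∧ ∃ V ∈ indepIn a b,
      LatticeEquiv 2 P (convexHull ℝ (intVec '' (V : Set (Fin 2 → ℤ)))) := by
  classical
  obtain ⟨V0, hV0⟩ := hP
  have hconv : Convex ℝ P := by rw [hV0]; exact convex_convexHull ℝ _
  have hfin : (latticePts 2 P).Finite := Set.finite_of_ncard_pos (by omega)
  set L := hfin.toFinset with hL
  have hLcard : L.card = w := by rw [← hcard, Set.ncard_eq_toFinset_card _ hfin]
  have memL : ∀ z, z ∈ L ↔ intVec z ∈ P := by intro z; rw [hL, Set.Finite.mem_toFinset]; rfl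
  have hV0L : V0 ⊆ L := by
    intro z hz
    rw [memL, hV0]
    exact subset_convexHull ℝ _ ⟨z, hz, rfl⟩
  have hspan : affineSpan ℝ (intVec '' (V0 : Set (Fin 2 → ℤ))) = ⊤ := by
    rw [← affineSpan_convexHull, ← hV0]; exact hf
  obtain ⟨p0, hp0, q0, hq0, r0, hr0, hdet0⟩ := exists_det_ne _ hspan
  obtain ⟨⟨p, q, r⟩, hmem, hmax⟩ := Finset.exists_max_image (L ×ˢ L ×ˢ L)
    (fun t => |det2 (t.2.1 - t.1) (t.2.2 - t.1)|) ⟨(p0, q0, r0), by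
      simp only [Finset.mem_product]; exact ⟨hV0L hp0, hV0L hq0, hV0L hr0⟩⟩
  simp only [Finset.mem_product, Prod.forall, and_imp] at hmem hmax
  obtain ⟨p, q, r, hp, hq, hr, hpos, hbd⟩ : ∃ p q r, p ∈ L ∧ q ∈ L ∧ r ∈ L ∧
      0 < det2 (q - p) (r - p) ∧ ∀ p' q' r', p' ∈ L → q' ∈ L → r' ∈ L →
        |det2 (q' - p') (r' - p')| ≤ det2 (q - p) (r - p) := by
    have h0 := hmax p0 q0 r0 (hV0L hp0) (hV0L hq0) (hV0L hr0)
    have h1 : 0 < |det2 (q - p) (r - p)| := lt_of_lt_of_le (abs_pos.2 hdet0) h0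
    rcases lt_or_gt_of_ne (abs_pos.1 h1) with h2 | h2
    · have e : det2 (r - p) (q - p) = - det2 (q - p) (r - p) := by simp only [det2]; ring
      refine ⟨p, r, q, hmem.1, hmem.2.2, hmem.2.1, by omega, ?_⟩
      rw [e, ← abs_of_neg h2]; exact hmax
    · refine ⟨p, q, r, hmem.1, hmem.2.1, hmem.2.2, h2, ?_⟩
      rw [abs_of_pos h2] at hmax; exact hmax
  set u := q - p with hu
  set v := r - p with hv
  set D := det2 u v with hD
  have cramer0 : ∀ y : Fin 2 → ℤ, D * y 0 = det2 y v * u 0 + det2 u y * v 0 := by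
    intro y; rw [hD]; simp only [det2]; ring
  have cramer1 : ∀ y : Fin 2 → ℤ, D * y 1 = det2 y v * u 1 + det2 u y * v 1 := by
    intro y; rw [hD]; simp only [det2]; ring
  have hDw : D ≤ 2 * w := by
    have := tri_count u v hpos (L.image (fun z => z - p)) (by
      intro z h1 h2 h3
      rw [Finset.mem_image]
      refine ⟨z + p, ?_, by simp⟩
      rw [memL]
      have hDr : (0 : ℝ) < D := by exact_mod_cast hpos
      have g1 : (0 : ℝ) ≤ det2 z v := by exact_mod_cast h1
      have g2 : (0 : ℝ) ≤ det2 u z := by exact_mod_cast h2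
      have g3 : (det2 z v : ℝ) + det2 u z ≤ D := by exact_mod_cast h3
      have hc := hconv.sum_mem (t := (Finset.univ : Finset (Fin 3)))
        (w := ![((D : ℝ) - det2 z v - det2 u z) / D, (det2 z v : ℝ) / D, (det2 u z : ℝ) / D])
        (z := ![intVec p, intVec q, intVec r])
        (by
          intro i _
          fin_cases i
          · simp only [Fin.zero_eta, Matrix.cons_val_zero]; apply div_nonneg _ hDr.le; linarith
          · simp only [Fin.mk_one, Matrix.cons_val_one]; exact div_nonneg g1 hDr.le
          · exact div_nonneg g2 hDr.le)
        (by simp [Fin.sum_univ_three]; field_simp; ring)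
        (by
          intro i _
          fin_cases i
          · exact (memL p).1 hp
          · exact (memL q).1 hq
          · exact (memL r).1 hr)
      convert hc using 1
      have c0 : (D : ℝ) * z 0 = det2 z v * (q 0 - p 0) + det2 u z * (r 0 - p 0) := by
        exact_mod_cast cramer0 z
      have c1 : (D : ℝ) * z 1 = det2 z v * (q 1 - p 1) + det2 u z * (r 1 - p 1) := by
        exact_mod_cast cramer1 z
      ext i
      fin_cases i
      · simp [Fin.sum_univ_three, intVec]; field_simp; linear_combination c0
      · simp [Fin.sum_univ_three, intVec]; field_simp; linear_combination c1)
    have h2 := Finset.card_image_le (s := L) (f := fun z => z - p)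
    rw [hLcard] at h2
    have h3 : (((L.image (fun z => z - p)).card : ℕ) : ℤ) ≤ w := by exact_mod_cast h2
    linarith
  obtain ⟨a, b, c, d, hdet, hg⟩ := gauss u v
  have hD2 : D = (a * u 0 + b * u 1) * (c * v 0 + d * v 1) -
      (c * u 0 + d * u 1) * (a * v 0 + b * v 1) := by
    rw [hD]; simp only [det2]
    linear_combination (-(u 0 * v 1 - u 1 * v 0)) * hdet
  have hbound : ∀ (s t x y : ℤ) (m : ℤ), |s| ≤ D → |t| ≤ D → D * m = s * x + t * y →
      |m| ≤ |x| + |y| := by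
    intro s t x y m hs ht h
    have : D * |m| ≤ D * (|x| + |y|) := by
      calc D * |m| = |D * m| := by rw [abs_mul, abs_of_pos hpos]
        _ ≤ |s| * |x| + |t| * |y| := by rw [h, ← abs_mul, ← abs_mul]; exact abs_add_le _ _
        _ ≤ D * |x| + D * |y| := by gcongr
        _ = _ := by ring
    exact le_of_mul_le_mul_left this hpos
  have hbx : ∀ z ∈ L, |a * (z 0 - p 0) + b * (z 1 - p 1)| ≤ |a * u 0 + b * u 1| + |a * v 0 + b * v 1| := by
    intro z hz
    refine hbound (det2 (z - p) v) (det2 u (z - p)) _ _ _ (hbd p z r hp hz hr) (hbd p q z hp hq hz) ?_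
    have k0 := cramer0 (z - p)
    have k1 := cramer1 (z - p)
    simp only [Pi.sub_apply] at k0 k1
    linear_combination a * k0 + b * k1
  have hby : ∀ z ∈ L, |c * (z 0 - p 0) + d * (z 1 - p 1)| ≤ |c * u 0 + d * u 1| + |c * v 0 + d * v 1| := by
    intro z hz
    refine hbound (det2 (z - p) v) (det2 u (z - p)) _ _ _ (hbd p z r hp hz hr) (hbd p q z hp hq hz) ?_
    have k0 := cramer0 (z - p)
    have k1 := cramer1 (z - p)
    simp only [Pi.sub_apply] at k0 k1
    linear_combination c * k0 + d * k1
  generalize hx : a * u 0 + b * u 1 = x at *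
  generalize hy : a * v 0 + b * v 1 = y at *
  generalize hz : c * u 0 + d * u 1 = z at *
  generalize ht : c * v 0 + d * v 1 = t at *
  have hA : ((x.natAbs + y.natAbs : ℕ) : ℤ) = |x| + |y| := by push_cast; rfl
  have hB : ((z.natAbs + t.natAbs : ℕ) : ℤ) = |z| + |t| := by push_cast; rfl
  refine ⟨x.natAbs + y.natAbs, z.natAbs + t.natAbs, ?_, ?_, ?_, ?_⟩
  · by_contra hlt
    have h1 : x = 0 := by omega
    have h2 : y = 0 := by omega
    rw [h1, h2] at hD2; simp at hD2; omega
  · by_contra hlt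
    have h1 : z = 0 := by omega
    have h2 : t = 0 := by omega
    rw [h1, h2] at hD2; simp at hD2; omega
  · zify
    have s1 : (|x| + |y|) ^ 2 ≤ 2 * (x ^ 2 + y ^ 2) := by
      nlinarith [sq_nonneg (|x| - |y|), sq_abs x, sq_abs y]
    have s2 : (|z| + |t|) ^ 2 ≤ 2 * (z ^ 2 + t ^ 2) := by
      nlinarith [sq_nonneg (|z| - |t|), sq_abs z, sq_abs t]
    have s3 := mul_le_mul s1 s2 (by positivity) (by positivity)
    have s4 : ((|x| + |y|) * (|z| + |t|)) ^ 2 ≤ (3 * D) ^ 2 := by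
      rw [← hD] at hg
      rw [mul_pow, mul_pow]
      linarith [sq_nonneg D]
    have s5 := abs_le_of_sq_le_sq s4 (by positivity)
    linarith [le_abs_self ((|x| + |y|) * (|z| + |t|))]
  · set τ : (Fin 2 → ℤ) → (Fin 2 → ℤ) := fun z =>
      ![a * (z 0 - p 0) + b * (z 1 - p 1), c * (z 0 - p 0) + d * (z 1 - p 1)] with hτ
    obtain ⟨V, hVs, hVi, hVh⟩ := exists_convIndep (V0.image τ)
    refine ⟨V, ?_, uniAff a b c d hdet p, uniAff_lattice a b c d hdet p, ?_⟩
    · simp only [indepIn, Finset.mem_filter, Finset.mem_powerset]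
      refine ⟨?_, hVi⟩
      intro m hm
      have := hVs hm
      rw [Finset.mem_image] at this
      obtain ⟨n, hn, rfl⟩ := this
      rw [mem_ibox, hA, hB]
      exact ⟨by simpa [hτ] using hbx n (hV0L hn), by simpa [hτ] using hby n (hV0L hn)⟩
    · rw [hVh, hV0]
      have := AffineMap.image_convexHull (uniAff a b c d hdet p).toAffineMap (intVec '' (V0 : Set (Fin 2 → ℤ)))
      rw [AffineEquiv.coe_toAffineMap] at this
      rw [this]
      congr 1
      rw [Finset.coe_image, Set.image_image, Set.image_image]
      apply Set.image_congr
      intro m _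
      rw [uniAff_intVec]


lemma eventually_pow_le_exp (C : ℝ) (k : ℕ) (δ : ℝ) (hδ : 0 < δ) :
    ∃ W : ℕ, ∀ w : ℕ, W ≤ w → C * (w : ℝ) ^ k ≤ Real.exp (δ * (w : ℝ) ^ ((1 : ℝ) / 3)) := by
  have h1 : Filter.Tendsto (fun w : ℕ => (w : ℝ) ^ ((1 : ℝ) / 3)) Filter.atTop Filter.atTop :=
    (tendsto_rpow_atTop (by norm_num)).comp tendsto_natCast_atTop_atTop
  have h2 := (isLittleO_pow_exp_pos_mul_atTop (3 * k) hδ).comp_tendsto h1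
  have h3 := h2.def (c := 1 / (|C| + 1)) (by positivity)
  rw [Filter.eventually_atTop] at h3
  obtain ⟨W, hW⟩ := h3
  refine ⟨W, fun w hw => ?_⟩
  have := hW w hw
  simp only [Function.comp, Real.norm_eq_abs, Real.abs_exp] at this
  have e : ((w : ℝ) ^ ((1 : ℝ) / 3)) ^ (3 * k) = (w : ℝ) ^ k := by
    rw [pow_mul, ← Real.rpow_natCast _ 3, ← Real.rpow_mul (by positivity)]; norm_num
  rw [e, abs_of_nonneg (by positivity), one_div, inv_mul_eq_div, le_div_iff₀ (by positivity)] at this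
  refine le_trans ?_ this
  rw [mul_comm]
  gcongr
  linarith [le_abs_self C]

/-- All normalized vertex sets. -/
def normSets (w : ℕ) : Finset (Finset (Fin 2 → ℤ)) :=
  ((Finset.Icc 1 (6 * w) ×ˢ Finset.Icc 1 (6 * w)).filter (fun t => t.1 * t.2 ≤ 6 * w)).biUnion
    (fun t => indepIn t.1 t.2)

lemma card_normSets (w : ℕ) (hw : 1 ≤ w) : ((normSets w).card : ℝ) ≤
    (36 * 55 ^ 4) * (w : ℝ) ^ 6 * Real.exp (36 * (w : ℝ) ^ ((1 : ℝ) / 3)) := by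
  set E := Real.exp (9 * (w : ℝ) ^ ((1 : ℝ) / 3)) with hE
  have hw' : (1 : ℝ) ≤ w := by exact_mod_cast hw
  have hE1 : 1 ≤ E := Real.one_le_exp (by positivity)
  have key : ∀ a b : ℕ, 1 ≤ a → 1 ≤ b → a * b ≤ 6 * w →
      ((indepIn a b).card : ℝ) ≤ (55 * w * E) ^ 4 := by
    intro a b ha hb hab
    have h1 : ((indepIn a b).card : ℝ) ≤ ((chainsIn a b).card : ℝ) ^ 4 := by
      exact_mod_cast card_indepIn_le a b
    refine h1.trans ?_
    gcongr
    have h2 : ((chainsIn a b).card : ℝ) ≤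
        1 + ((2 * a + 1) * (2 * b + 1)) * ((stepSets (2 * a) (2 * b)).card : ℝ) := by
      exact_mod_cast card_chainsIn_le a b
    have h3 : ((stepSets (2 * a) (2 * b)).card : ℝ) ≤ E := by
      refine (card_stepSets_le (2 * a) (2 * b) (by omega) (by omega)).trans ?_
      apply Real.exp_le_exp.2
      have hab' : ((2 * a : ℕ) : ℝ) * ((2 * b : ℕ) : ℝ) ≤ 27 * w := by
        have : (a : ℝ) * b ≤ 6 * w := by exact_mod_cast hab
        push_cast
        nlinarith
      have h27 : (27 * (w : ℝ)) ^ ((1 : ℝ) / 3) = 3 * (w : ℝ) ^ ((1 : ℝ) / 3) := by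
        rw [Real.mul_rpow (by norm_num) (by positivity)]
        congr 1
        rw [show (27 : ℝ) = 3 ^ (3 : ℝ) by norm_num, ← Real.rpow_mul (by norm_num)]
        norm_num
      have := Real.rpow_le_rpow (by positivity) hab' (show (0 : ℝ) ≤ 1 / 3 by norm_num)
      rw [h27] at this
      linarith
    have h4 : ((2 * a + 1) * (2 * b + 1) : ℝ) ≤ 54 * w := by
      have : (2 * a + 1) * (2 * b + 1) ≤ 54 * w := by
        have h5 : (2 * a + 1) * (2 * b + 1) ≤ (3 * a) * (3 * b) :=
          Nat.mul_le_mul (by omega) (by omega)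
        have h6 : (3 * a) * (3 * b) = 9 * (a * b) := by ring
        omega
      exact_mod_cast this
    calc ((chainsIn a b).card : ℝ) ≤ 1 + (54 * w) * E := by
          refine h2.trans ?_
          gcongr
      _ ≤ 55 * w * E := by nlinarith
  have hsum : ((normSets w).card : ℝ) ≤ (36 * w ^ 2) * (55 * w * E) ^ 4 := by
    have h1 : ((normSets w).card : ℝ) ≤ ∑ t ∈ (Finset.Icc 1 (6 * w) ×ˢ Finset.Icc 1 (6 * w)).filter
        (fun t => t.1 * t.2 ≤ 6 * w), ((indepIn t.1 t.2).card : ℝ) := by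
      exact_mod_cast Finset.card_biUnion_le
    refine h1.trans ((Finset.sum_le_card_nsmul _ _ ((55 * w * E) ^ 4) ?_).trans ?_)
    · intro t ht
      simp only [Finset.mem_filter, Finset.mem_product, Finset.mem_Icc] at ht
      exact key t.1 t.2 ht.1.1.1 ht.1.2.1 ht.2
    · rw [nsmul_eq_mul]
      gcongr
      have : ((Finset.Icc 1 (6 * w) ×ˢ Finset.Icc 1 (6 * w)).filter
        (fun t : ℕ × ℕ => t.1 * t.2 ≤ 6 * w)).card ≤ 36 * w ^ 2 := by
        refine (Finset.card_filter_le _ _).trans ?_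
        simp [Finset.card_product]; nlinarith
      exact_mod_cast this
  refine hsum.trans (le_of_eq ?_)
  have : Real.exp (36 * (w : ℝ) ^ ((1 : ℝ) / 3)) = E ^ 4 := by
    rw [hE, ← Real.exp_nat_mul]; congr 1; push_cast; ring
  rw [this]; ring

lemma exists_inj (w : ℕ) (hw : 1 ≤ w) :
    ∃ f : ClassesType 2 (fun P => (latticePts 2 P).ncard = w) → normSets w,
      Function.Injective f := by
  have : ∀ c : ClassesType 2 (fun P => (latticePts 2 P).ncard = w), ∃ V : normSets w,
      ∃ P, Quot.mk _ P = c ∧ LatticeEquiv 2 P.1 (convexHull ℝ (intVec '' (V.1 : Set (Fin 2 → ℤ)))) := by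
    intro c
    obtain ⟨P, rfl⟩ := Quot.exists_rep c
    obtain ⟨a, b, ha, hb, hab, V, hV, he⟩ :=
      polygon_normalize P.1 w hw P.2.1 P.2.2.1 P.2.2.2
    refine ⟨⟨V, ?_⟩, P, rfl, he⟩
    simp only [normSets, Finset.mem_biUnion, Finset.mem_filter, Finset.mem_product, Finset.mem_Icc]
    refine ⟨(a, b), ⟨⟨⟨ha, ?_⟩, hb, ?_⟩, hab⟩, hV⟩
    · simp only; nlinarith
    · simp only; nlinarith
  choose f hf using this
  refine ⟨f, ?_⟩
  intro c c' h
  obtain ⟨P, hP, e⟩ := hf c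
  obtain ⟨P', hP', e'⟩ := hf c'
  rw [← hP, ← hP']
  apply Quot.sound
  rw [h] at e
  exact e.trans' e'.symm'

lemma upper_bound : ∃ W : ℕ, ∀ w : ℕ, W ≤ w →
      Finite (ClassesType 2 (fun P => (latticePts 2 P).ncard = w)) ∧
      (Nat.card (ClassesType 2 (fun P => (latticePts 2 P).ncard = w)) : ℝ) ≤
        Real.exp (37 * (w : ℝ) ^ ((1 : ℝ) / 3)) := by
  obtain ⟨W, hW⟩ := eventually_pow_le_exp (36 * 55 ^ 4) 6 1 one_pos
  refine ⟨max W 1, fun w hw => ?_⟩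
  have hw1 : 1 ≤ w := le_trans (le_max_right _ _) hw
  have hw2 := hW w (le_trans (le_max_left _ _) hw)
  obtain ⟨f, hf⟩ := exists_inj w hw1
  refine ⟨Finite.of_injective f hf, ?_⟩
  have h1 : Nat.card (ClassesType 2 (fun P => (latticePts 2 P).ncard = w)) ≤ (normSets w).card := by
    have := Nat.card_le_card_of_injective f hf
    simpa using this
  have h2 : (Nat.card (ClassesType 2 (fun P => (latticePts 2 P).ncard = w)) : ℝ) ≤ (normSets w).card := by
    exact_mod_cast h1
  refine h2.trans ((card_normSets w hw1).trans ?_)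
  have : Real.exp (37 * (w : ℝ) ^ ((1 : ℝ) / 3)) = Real.exp (1 * (w : ℝ) ^ ((1 : ℝ) / 3)) *
      Real.exp (36 * (w : ℝ) ^ ((1 : ℝ) / 3)) := by
    rw [← Real.exp_add]; congr 1; ring
  rw [this]
  gcongr


lemma hull_le (V : Set (Fin 2 → ℤ)) (c0 c1 k : ℤ) (h : ∀ v ∈ V, c0 * v 0 + c1 * v 1 ≤ k)
    (z : Fin 2 → ℤ) (hz : intVec z ∈ convexHull ℝ (intVec '' V)) : c0 * z 0 + c1 * z 1 ≤ k := by
  have hl : IsLinearMap ℝ (fun x : Fin 2 → ℝ => (c0 : ℝ) * x 0 + c1 * x 1) :=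
    ⟨fun x y => by simp; ring, fun a x => by simp; ring⟩
  have hc := convex_halfSpace_le hl (k : ℝ)
  have := convexHull_min (s := intVec '' V) (by
    rintro _ ⟨v, hv, rfl⟩
    have := h v hv
    change (c0 : ℝ) * (v 0 : ℝ) + c1 * (v 1 : ℝ) ≤ k
    exact_mod_cast this) hc hz
  have h2 : (c0 : ℝ) * (z 0 : ℝ) + c1 * (z 1 : ℝ) ≤ k := this
  exact_mod_cast h2

/-- Lower boundary. -/
def lowF (T : Finset ℕ) (i : ℕ) : ℕ := i ^ 2 + if i ∈ T then 1 else 0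
/-- Total of columns. -/
def totM (n w : ℕ) (T : Finset ℕ) : ℕ := w + ∑ i ∈ Finset.range (n + 1), lowF T i
/-- Upper boundary (exclusive). -/
def upF (n w : ℕ) (T : Finset ℕ) (i : ℕ) : ℕ :=
  totM n w T / (n + 1) + if i < totM n w T % (n + 1) then 1 else 0

/-- Lattice points of the constructed polygons. -/
def polySet (n w : ℕ) (T : Finset ℕ) : Finset (Fin 2 → ℤ) :=
  ((Finset.range (n + 1)).sigma (fun i => Finset.Ico (lowF T i) (upF n w T i))).image
    (fun t => ![(t.1 : ℤ), (t.2 : ℤ)])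

lemma mem_polySet (n w : ℕ) (T : Finset ℕ) (z : Fin 2 → ℤ) : z ∈ polySet n w T ↔
    ∃ i y : ℕ, i ≤ n ∧ lowF T i ≤ y ∧ y < upF n w T i ∧ z = ![(i : ℤ), (y : ℤ)] := by
  simp only [polySet, Finset.mem_image, Finset.mem_sigma, Finset.mem_range, Finset.mem_Ico, Sigma.exists]
  constructor
  · rintro ⟨i, y, ⟨h1, h2, h3⟩, rfl⟩
    exact ⟨i, y, by omega, h2, h3, rfl⟩
  · rintro ⟨i, y, h1, h2, h3, rfl⟩
    exact ⟨i, y, ⟨by omega, h2, h3⟩, rfl⟩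

lemma lowF_le (T : Finset ℕ) (i : ℕ) : lowF T i ≤ i ^ 2 + 1 := by
  unfold lowF; split_ifs <;> omega

lemma le_div (n w : ℕ) (T : Finset ℕ) (hn : 2 ≤ n) (hw : 8 * n ^ 3 ≤ w) :
    n ^ 2 + 3 ≤ totM n w T / (n + 1) := by
  rw [Nat.le_div_iff_mul_le (by omega)]
  unfold totM
  have : (n ^ 2 + 3) * (n + 1) ≤ 8 * n ^ 3 := by
    obtain ⟨m, rfl⟩ := Nat.exists_eq_add_of_le hn
    ring_nf; nlinarith
  omega

lemma low_le_up (n w : ℕ) (T : Finset ℕ) (hn : 2 ≤ n) (hw : 8 * n ^ 3 ≤ w) (i : ℕ) (hi : i ≤ n) :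
    lowF T i + 2 ≤ upF n w T i := by
  have h1 := le_div n w T hn hw
  have h2 := lowF_le T i
  have h3 : i ^ 2 ≤ n ^ 2 := Nat.pow_le_pow_left hi 2
  unfold upF
  omega

lemma card_polySet (n w : ℕ) (T : Finset ℕ) (hn : 2 ≤ n) (hw : 8 * n ^ 3 ≤ w) :
    (polySet n w T).card = w := by
  rw [polySet, Finset.card_image_of_injOn, Finset.card_sigma]
  · simp only [Nat.card_Ico]
    have h1 : ∑ i ∈ Finset.range (n + 1), (upF n w T i - lowF T i) +
        ∑ i ∈ Finset.range (n + 1), lowF T i = ∑ i ∈ Finset.range (n + 1), upF n w T i := by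
      rw [← Finset.sum_add_distrib]
      apply Finset.sum_congr rfl
      intro i hi
      have := low_le_up n w T hn hw i (by simp at hi; omega)
      omega
    have h2 : ∑ i ∈ Finset.range (n + 1), upF n w T i = totM n w T := by
      unfold upF
      rw [Finset.sum_add_distrib, Finset.sum_const, Finset.card_range, smul_eq_mul,
        ← Finset.card_filter]
      have : (Finset.range (n + 1)).filter (fun i => i < totM n w T % (n + 1)) =
          Finset.range (totM n w T % (n + 1)) := by
        ext i
        have := Nat.mod_lt (totM n w T) (show 0 < n + 1 by omega)
        simp; omega
      rw [this, Finset.card_range]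
      exact Nat.div_add_mod _ _
    rw [h2, totM] at h1
    omega
  · rintro ⟨i, y⟩ _ ⟨i', y'⟩ _ h
    have h0 := congrFun h 0
    have h1 := congrFun h 1
    simp at h0 h1
    subst h0; subst h1; rfl

/-- The constructed polygon. -/
def polyP (n w : ℕ) (T : Finset ℕ) : Set (Fin 2 → ℝ) :=
  convexHull ℝ (intVec '' (polySet n w T : Set (Fin 2 → ℤ)))

lemma latticePts_polyP (n w : ℕ) (T : Finset ℕ) (hn : 2 ≤ n) (hw : 8 * n ^ 3 ≤ w) :
    latticePts 2 (polyP n w T) = polySet n w T := by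
  apply subset_antisymm
  swap
  · intro z hz
    exact subset_convexHull ℝ _ ⟨z, hz, rfl⟩
  intro z hz
  change intVec z ∈ convexHull ℝ _ at hz
  have hmod := Nat.mod_lt (totM n w T) (show 0 < n + 1 by omega)
  set Q := totM n w T / (n + 1) with hQ
  set r := totM n w T % (n + 1) with hr
  have hup : ∀ i, upF n w T i = Q + if i < r then 1 else 0 := fun i => rfl
  have a1 := hull_le _ (-1) 0 0 (by
    intro v hv
    obtain ⟨i, y, -, -, -, rfl⟩ := (mem_polySet n w T v).1 hv
    simp) z hz
  have a2 := hull_le _ 1 0 n (by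
    intro v hv
    obtain ⟨i, y, hi, -, -, rfl⟩ := (mem_polySet n w T v).1 hv
    simp; omega) z hz
  obtain ⟨i, hi⟩ : ∃ i : ℕ, z 0 = i := ⟨(z 0).toNat, by omega⟩
  have hin : i ≤ n := by omega
  have a3 := hull_le _ (2 * i) (-1) (2 * i * i - lowF T i) (by
    intro v hv
    obtain ⟨j, y, hj, hy, -, rfl⟩ := (mem_polySet n w T v).1 hv
    simp only [Matrix.cons_val_zero, Matrix.cons_val_one]
    have hy' : ((lowF T j : ℕ) : ℤ) ≤ y := by exact_mod_cast hy
    by_cases hij : i = j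
    · subst hij; linarith
    · have h1 : (1 : ℤ) ≤ ((i : ℤ) - j) ^ 2 := by
        have : ((i : ℤ) - j) ≠ 0 := by omega
        have := sq_pos_of_ne_zero this
        omega
      have h2 : ((lowF T i : ℕ) : ℤ) ≤ (i : ℤ) ^ 2 + 1 := by exact_mod_cast lowF_le T i
      have h3 : ((j : ℕ) : ℤ) ^ 2 ≤ lowF T j := by
        have : j ^ 2 ≤ lowF T j := by unfold lowF; omega
        exact_mod_cast this
      nlinarith) z hz
  have a4 := hull_le _ 0 1 Q (by
    intro v hv
    obtain ⟨j, y, hj, -, hy, rfl⟩ := (mem_polySet n w T v).1 hv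
    rw [hup] at hy
    simp only [Matrix.cons_val_zero, Matrix.cons_val_one]
    split_ifs at hy <;> omega) z hz
  have a5 := hull_le _ 1 (n + 1 - r) (n + (n + 1 - r) * (Q - 1)) (by
    intro v hv
    obtain ⟨j, y, hj, -, hy, rfl⟩ := (mem_polySet n w T v).1 hv
    rw [hup] at hy
    simp only [Matrix.cons_val_zero, Matrix.cons_val_one]
    by_cases hjr : j < r ∧ y = Q
    · obtain ⟨h1, rfl⟩ := hjr
      have : (j : ℤ) + 1 ≤ r := by omega
      linarith
    · have h1 : (y : ℤ) ≤ Q - 1 := by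
        by_cases hjr' : j < r
        · rw [if_pos hjr'] at hy; omega
        · rw [if_neg hjr'] at hy; omega
      have h2 : (0 : ℤ) ≤ n + 1 - r := by omega
      have := mul_le_mul_of_nonneg_left h1 h2
      have h3 : (j : ℤ) ≤ n := by omega
      linarith) z hz
  have a3' : ((lowF T i : ℕ) : ℤ) ≤ z 1 := by rw [hi] at a3; linarith
  obtain ⟨y, hy⟩ : ∃ y : ℕ, z 1 = y := ⟨(z 1).toNat, by omega⟩
  rw [Finset.mem_coe, mem_polySet]
  refine ⟨i, y, hin, by omega, ?_, ?_⟩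
  · rw [hup]
    rw [hy] at a4 a5
    rw [hi] at a5
    by_cases hyQ : y = Q
    · subst hyQ
      have : i < r := by
        have : (i : ℤ) < r := by linarith
        omega
      rw [if_pos this]; omega
    · split_ifs <;> omega
  · ext k; fin_cases k <;> simp [hi, hy]

/-- Three base points. -/
def baseB : Fin 3 → (Fin 2 → ℤ) := ![![0, 1], ![0, 2], ![1, 2]]

lemma span_baseB : affineSpan ℝ (Set.range (fun j => intVec (baseB j))) = ⊤ := by
  set S := affineSpan ℝ (Set.range (fun j => intVec (baseB j)))
  have hm : ∀ j, intVec (baseB j) ∈ S := fun j => subset_affineSpan ℝ _ ⟨j, rfl⟩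
  rw [← AffineSubspace.direction_eq_top_iff_of_nonempty ⟨_, hm 0⟩, eq_top_iff]
  intro x _
  have h1 := AffineSubspace.vsub_mem_direction (hm 1) (hm 0)
  have h2 := AffineSubspace.vsub_mem_direction (hm 2) (hm 1)
  have : x = x 1 • (intVec (baseB 1) -ᵥ intVec (baseB 0)) + x 0 • (intVec (baseB 2) -ᵥ intVec (baseB 1)) := by
    ext k; fin_cases k <;> simp [intVec, baseB] <;> ring
  rw [this]
  exact Submodule.add_mem _ (Submodule.smul_mem _ _ h1) (Submodule.smul_mem _ _ h2)

lemma baseB_mem (n w : ℕ) (T : Finset ℕ) (hn : 2 ≤ n) (hw : 8 * n ^ 3 ≤ w) (j : Fin 3) :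
    baseB j ∈ polySet n w T := by
  rw [mem_polySet]
  have h1 := le_div n w T hn hw
  have h0 : 4 ≤ n ^ 2 := by nlinarith
  have hup : ∀ i, 7 ≤ upF n w T i := by intro i; unfold upF; omega
  have l0 := lowF_le T 0
  have l1 := lowF_le T 1
  have u0 := hup 0
  have u1 := hup 1
  fin_cases j
  · exact ⟨0, 1, by omega, by omega, by omega, by simp [baseB]⟩
  · exact ⟨0, 2, by omega, by omega, by omega, by simp [baseB]⟩
  · exact ⟨1, 2, by omega, by omega, by omega, by simp [baseB]⟩

lemma fullDim_polyP (n w : ℕ) (T : Finset ℕ) (hn : 2 ≤ n) (hw : 8 * n ^ 3 ≤ w) :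
    IsFullDim 2 (polyP n w T) := by
  unfold IsFullDim
  rw [eq_top_iff, ← span_baseB]
  apply affineSpan_mono
  rintro _ ⟨j, rfl⟩
  exact subset_convexHull ℝ _ ⟨_, baseB_mem n w T hn hw j, rfl⟩

lemma polySet_inj (n w : ℕ) (T T' : Finset ℕ) (hn : 2 ≤ n) (hw : 8 * n ^ 3 ≤ w)
    (hT : T ⊆ Finset.range (n + 1)) (hT' : T' ⊆ Finset.range (n + 1))
    (h : polySet n w T = polySet n w T') : T = T' := by
  have key : ∀ T : Finset ℕ, T ⊆ Finset.range (n + 1) → ∀ i, i ∈ T ↔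
      (i ≤ n ∧ ![(i : ℤ), ((i ^ 2 : ℕ) : ℤ)] ∉ polySet n w T) := by
    intro T hT i
    constructor
    · intro hi
      refine ⟨by have := hT hi; simp at this; omega, ?_⟩
      rw [mem_polySet]
      rintro ⟨i', y, -, h2, -, e⟩
      have e0 := congrFun e 0
      have e1 := congrFun e 1
      simp only [Matrix.cons_val_zero, Matrix.cons_val_one, Nat.cast_inj] at e0 e1
      subst e0; subst e1
      rw [lowF, if_pos hi] at h2; omega
    · rintro ⟨hi, hmem⟩
      by_contra hiT
      apply hmem
      rw [mem_polySet]
      refine ⟨i, i ^ 2, hi, by rw [lowF, if_neg hiT]; omega, ?_, rfl⟩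
      have := low_le_up n w T hn hw i hi
      unfold lowF at this; omega
  ext i
  rw [key T hT, key T' hT', h]

/-- The constructed polygon as an element of the subtype. -/
def polyElt (n w : ℕ) (hn : 2 ≤ n) (hw : 8 * n ^ 3 ≤ w) (T : Finset ℕ) :
    {P : Set (Fin 2 → ℝ) // IsConvexLatticePolytope 2 P ∧ IsFullDim 2 P ∧ (latticePts 2 P).ncard = w} :=
  ⟨polyP n w T, ⟨polySet n w T, rfl⟩, fullDim_polyP n w T hn hw, by
    rw [latticePts_polyP n w T hn hw, Set.ncard_coe_finset, card_polySet n w T hn hw]⟩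

lemma card_fiber (n w : ℕ) (hn : 2 ≤ n) (hw : 8 * n ^ 3 ≤ w) (F : Finset (Finset ℕ))
    (hF : ∀ T ∈ F, T ⊆ Finset.range (n + 1)) (T0 : Finset ℕ)
    (h : ∀ T ∈ F, LatticeEquiv 2 (polyP n w T0) (polyP n w T)) : F.card ≤ w ^ 3 := by
  classical
  have h1 : ∀ T : Finset ℕ, ∃ m : Fin 3 → (Fin 2 → ℤ), T ∈ F →
      ((∀ j, m j ∈ polySet n w T0) ∧ ∃ σ : (Fin 2 → ℝ) ≃ᵃ[ℝ] (Fin 2 → ℝ),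
        polyP n w T = σ '' polyP n w T0 ∧ ∀ j, σ (intVec (m j)) = intVec (baseB j)) := by
    intro T
    by_cases hT : T ∈ F
    · obtain ⟨σ, e1, e2⟩ := h T hT
      have : ∀ j, ∃ m : Fin 2 → ℤ, m ∈ polySet n w T0 ∧ σ (intVec m) = intVec (baseB j) := by
        intro j
        have hb : intVec (baseB j) ∈ polyP n w T :=
          subset_convexHull ℝ _ ⟨_, baseB_mem n w T hn hw j, rfl⟩
        have hb' : intVec (baseB j) ∈ latticeSet 2 := ⟨_, rfl⟩
        rw [← e1] at hb'
        obtain ⟨_, ⟨m, rfl⟩, hm⟩ := hb'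
        rw [e2] at hb
        obtain ⟨x, hx, hxe⟩ := hb
        have : x = intVec m := σ.injective (hxe.trans hm.symm)
        subst this
        refine ⟨m, ?_, hm⟩
        have : m ∈ latticePts 2 (polyP n w T0) := hx
        rw [latticePts_polyP n w T0 hn hw] at this
        exact this
      choose m hm using this
      exact ⟨m, fun _ => ⟨fun j => (hm j).1, σ, e2, fun j => (hm j).2⟩⟩
    · exact ⟨0, fun h => absurd h hT⟩
  choose m hm using h1
  have hc : (Fintype.piFinset (fun _ : Fin 3 => polySet n w T0)).card = w ^ 3 := by
    simp [card_polySet n w T0 hn hw]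
  rw [← hc]
  apply Finset.card_le_card_of_injOn m
  · intro T hT
    simp only [Finset.mem_coe, Fintype.mem_piFinset]
    exact (hm T hT).1
  · intro T hT T' hT' e
    obtain ⟨-, σ, hσ, hσm⟩ := hm T hT
    obtain ⟨-, σ', hσ', hσm'⟩ := hm T' hT'
    have hs : σ.symm.toAffineMap = σ'.symm.toAffineMap := by
      apply AffineMap.ext_on span_baseB
      rintro _ ⟨j, rfl⟩
      simp only [AffineEquiv.coe_toAffineMap]
      have g1 : σ.symm (intVec (baseB j)) = intVec (m T j) := by rw [← hσm j]; simp
      have g2 : σ'.symm (intVec (baseB j)) = intVec (m T' j) := by rw [← hσm' j]; simp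
      rw [g1, g2, e]
    have hs' : σ.symm = σ'.symm := AffineEquiv.toAffineMap_injective hs
    have hs'' : σ = σ' := congrArg AffineEquiv.symm hs'
    have hP : polyP n w T = polyP n w T' := by rw [hσ, hσ', hs'']
    have hl := congrArg (latticePts 2) hP
    rw [latticePts_polyP n w T hn hw, latticePts_polyP n w T' hn hw] at hl
    exact polySet_inj n w T T' hn hw (hF T hT) (hF T' hT') (by exact_mod_cast hl)

lemma lower_count (n w : ℕ) (hn : 2 ≤ n) (hw : 8 * n ^ 3 ≤ w)
    (hfin : Finite (ClassesType 2 (fun P => (latticePts 2 P).ncard = w))) :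
    2 ^ (n + 1) ≤ w ^ 3 * Nat.card (ClassesType 2 (fun P => (latticePts 2 P).ncard = w)) := by
  classical
  have := Fintype.ofFinite (ClassesType 2 (fun P => (latticePts 2 P).ncard = w))
  set g : Finset ℕ → ClassesType 2 (fun P => (latticePts 2 P).ncard = w) :=
    fun T => Quot.mk _ (polyElt n w hn hw T) with hg
  have h := Finset.card_le_mul_card_image_of_maps_to (s := (Finset.range (n + 1)).powerset)
    (t := Finset.univ) (f := g) (fun _ _ => Finset.mem_univ _) (w ^ 3) (by
      intro c _
      rcases ((Finset.range (n + 1)).powerset.filter (fun T => g T = c)).eq_empty_or_nonempty with h0 | ⟨T0, hT0⟩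
      · rw [h0]; simp
      · apply card_fiber n w hn hw _ (by intro T hT; simpa using (Finset.mem_filter.1 hT).1) T0
        intro T hT
        have e : g T0 = g T := (Finset.mem_filter.1 hT0).2.trans (Finset.mem_filter.1 hT).2.symm
        have e2 := Quot.eqvGen_exact e
        have heq : Equivalence (fun P₁ P₂ : {P : Set (Fin 2 → ℝ) // IsConvexLatticePolytope 2 P ∧
            IsFullDim 2 P ∧ (latticePts 2 P).ncard = w} => LatticeEquiv 2 P₁.1 P₂.1) :=
          ⟨fun P => LatticeEquiv.refl' _, fun h => h.symm', fun h h' => h.trans' h'⟩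
        exact heq.eqvGen_iff.1 e2)
  rw [Finset.card_powerset, Finset.card_range, Finset.card_univ, ← Nat.card_eq_fintype_card] at h
  exact h

lemma lower_bound : ∃ W : ℕ, ∀ w : ℕ, W ≤ w →
    Finite (ClassesType 2 (fun P => (latticePts 2 P).ncard = w)) →
      Real.exp ((1 / 10) * (w : ℝ) ^ ((1 : ℝ) / 3)) ≤
      (Nat.card (ClassesType 2 (fun P => (latticePts 2 P).ncard = w)) : ℝ) := by
  obtain ⟨W, hW⟩ := eventually_pow_le_exp 1 3 (1 / 10) (by norm_num)
  refine ⟨max W 64, fun w hw hfin => ?_⟩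
  have hw1 := hW w (le_trans (le_max_left _ _) hw)
  have hw2 : 64 ≤ w := le_trans (le_max_right _ _) hw
  have hw2' : (64 : ℝ) ≤ w := by exact_mod_cast hw2
  set x := (w : ℝ) ^ ((1 : ℝ) / 3) with hx
  have hx0 : 0 ≤ x := by positivity
  have hx3 : x ^ 3 = w := by
    rw [hx, ← Real.rpow_natCast, ← Real.rpow_mul (by positivity)]; norm_num
  have hx4 : 4 ≤ x := by
    by_contra hlt
    push Not at hlt
    have : x ^ 3 < 4 ^ 3 := by gcongr
    linarith
  set n := ⌊x / 2⌋₊ with hn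
  have hnle : (n : ℝ) ≤ x / 2 := Nat.floor_le (by positivity)
  have hnlt : x / 2 < n + 1 := Nat.lt_floor_add_one _
  have hn2 : 2 ≤ n := Nat.le_floor (by push_cast; linarith)
  have h8 : 8 * n ^ 3 ≤ w := by
    have : (8 : ℝ) * n ^ 3 ≤ w := by
      calc (8 : ℝ) * n ^ 3 ≤ 8 * (x / 2) ^ 3 := by gcongr
        _ = (w : ℝ) := by rw [← hx3]; ring
    exact_mod_cast this
  have hc := lower_count n w hn2 h8 hfin
  have hc' : (2 : ℝ) ^ (n + 1) ≤ (w : ℝ) ^ 3 *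
      (Nat.card (ClassesType 2 (fun P => (latticePts 2 P).ncard = w)) : ℝ) := by exact_mod_cast hc
  set K := (Nat.card (ClassesType 2 (fun P => (latticePts 2 P).ncard = w)) : ℝ)
  have hK : 0 ≤ K := Nat.cast_nonneg _
  have h2 : Real.exp ((1 / 5) * x) ≤ 2 ^ (n + 1) := by
    have : (2 : ℝ) ^ (n + 1) = Real.exp (((n + 1 : ℕ) : ℝ) * Real.log 2) := by
      rw [Real.exp_nat_mul, Real.exp_log (by norm_num)]
    rw [this]
    apply Real.exp_le_exp.2
    have hl := Real.log_two_gt_d9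
    push_cast
    nlinarith
  have h3 : Real.exp ((1 / 10) * x) * Real.exp ((1 / 10) * x) ≤ Real.exp ((1 / 10) * x) * K := by
    rw [← Real.exp_add]
    calc Real.exp (1 / 10 * x + 1 / 10 * x) = Real.exp ((1 / 5) * x) := by congr 1; ring
      _ ≤ (w : ℝ) ^ 3 * K := h2.trans hc'
      _ ≤ _ := by
        rw [one_mul] at hw1
        gcongr
  exact le_of_mul_le_mul_left h3 (Real.exp_pos _)

/-- **Theorem 2.** For all sufficiently large `w`, the number `κ(2,w)` of
equivalence classes of convex lattice polygons with exactly `w` lattice points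
is finite and satisfies `exp(c₁ w^{1/3}) ≤ κ(2,w) ≤ exp(c₂ w^{1/3})`. -/
theorem kappa_two_bounds :
    ∃ c₁ c₂ : ℝ, 0 < c₁ ∧ 0 < c₂ ∧ ∃ W : ℕ, ∀ w : ℕ, W ≤ w →
      Finite (ClassesType 2 (fun P => (latticePts 2 P).ncard = w)) ∧
      Real.exp (c₁ * (w : ℝ) ^ ((1 : ℝ) / 3)) ≤
        (Nat.card (ClassesType 2 (fun P => (latticePts 2 P).ncard = w)) : ℝ) ∧
      (Nat.card (ClassesType 2 (fun P => (latticePts 2 P).ncard = w)) : ℝ) ≤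
        Real.exp (c₂ * (w : ℝ) ^ ((1 : ℝ) / 3)) := by
  obtain ⟨W₁, h₁⟩ := upper_bound
  obtain ⟨W₂, h₂⟩ := lower_bound
  refine ⟨1 / 10, 37, by norm_num, by norm_num, max W₁ W₂, fun w hw => ?_⟩
  have hu := h₁ w (le_trans (le_max_left _ _) hw)
  have hl := h₂ w (le_trans (le_max_right _ _) hw) hu.1
  exact ⟨hu.1, hl, hu.2⟩

end
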